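/- arXiv:2403.05142 — 5 statements merged into one kernel-verified Lean document; each statement's English description precedes it below -/
import Mathlib

section
/- Let F be a field and n a positive integer. With P and Q the (n+1)×(n+1) matrices defined by: P has first row all 1's and for 2 ≤ k ≤ n+1 its row k has P_{k,n+1} = 1, P_{k,n+2−k} = −1 and zeros elsewhere; Q has last row all 1's and for 1 ≤ k ≤ n its row k has Q_{k,n+2−k} = −n and all other entries 1. If a is an (n+1)×(n+1) matrix over F whose last row and last column are zero, then every row sum and every column sum of P*a*Q equals 0. -/
open Matrix BigOperators

/-- The matrix `P`: first row (index 0) all `1`'s; for rows `i ≥ 1`, the entry in the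
last column is `1`, the entry in column `n - i` is `-1`, and all other entries are `0`.
(1-based: `P_{1,l} = 1`, and for `2 ≤ k ≤ n+1`: `P_{k,n+1} = 1`, `P_{k,n+2-k} = -1`.) -/
def Pmat (F : Type*) [Field F] (n : ℕ) : Matrix (Fin (n + 1)) (Fin (n + 1)) F :=
  Matrix.of fun i j =>
    if (i : ℕ) = 0 then 1
    else if (j : ℕ) = n then 1
    else if (i : ℕ) + (j : ℕ) = n then -1
    else 0

/-- The matrix `Q`: last row (index n) all `1`'s; for rows `i ≤ n - 1`, the entry in
column `n - i` is `-n` and all other entries are `1`.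
(1-based: `Q_{n+1,l} = 1`, and for `1 ≤ k ≤ n`: `Q_{k,n+2-k} = -n`, `Q_{k,l} = 1` otherwise.) -/
def Qmat (F : Type*) [Field F] (n : ℕ) : Matrix (Fin (n + 1)) (Fin (n + 1)) F :=
  Matrix.of fun i j =>
    if (i : ℕ) = n then 1
    else if (i : ℕ) + (j : ℕ) = n then -(n : F)
    else 1

theorem sum_Qmat_row_eq_zero (F : Type*) [Field F] (n : ℕ) (i : Fin (n + 1))
    (hi : i ≠ Fin.last n) : ∑ k, Qmat F n i k = 0 := by
  have hi' : (i : ℕ) ≠ n := fun h => hi (Fin.ext h)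
  have h : ∀ k, Qmat F n i k = 1 - if k = i.rev then (n : F) + 1 else 0 := by
    intro k
    have hk : k = i.rev ↔ (i : ℕ) + k = n := by
      rw [Fin.ext_iff, Fin.val_rev]; omega
    simp only [Qmat, Matrix.of_apply, if_neg hi', hk]
    split_ifs <;> ring
  simp [h, Finset.sum_sub_distrib]

theorem sum_Pmat_col_eq_zero (F : Type*) [Field F] (n : ℕ) (j : Fin (n + 1))
    (hj : j ≠ Fin.last n) : ∑ k, Pmat F n k j = 0 := by
  have hj' : (j : ℕ) ≠ n := fun h => hj (Fin.ext h)
  have h : ∀ k, Pmat F n k j = (if k = 0 then 1 else 0) - if k = j.rev then 1 else 0 := by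
    intro k
    have hk : k = j.rev ↔ (k : ℕ) + j = n := by
      rw [Fin.ext_iff, Fin.val_rev]; omega
    have hk0 : k = 0 ↔ (k : ℕ) = 0 := Fin.ext_iff
    simp only [Pmat, Matrix.of_apply, if_neg hj', hk, hk0]
    split_ifs <;> first | omega | ring
  simp [h, Finset.sum_sub_distrib]

/-- If the last row and last column of `a` vanish, then every row sum and every
column sum of `P * a * Q` equals `0`. -/
theorem Pmat_conj_row_col_sums_zero (F : Type*) [Field F] (n : ℕ) (hn : 0 < n)
    (a : Matrix (Fin (n + 1)) (Fin (n + 1)) F)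
    (hrow : ∀ j, a (Fin.last n) j = 0) (hcol : ∀ i, a i (Fin.last n) = 0) :
    (∀ l, ∑ k, (Pmat F n * a * Qmat F n) l k = 0) ∧
    (∀ l, ∑ k, (Pmat F n * a * Qmat F n) k l = 0) := by
  refine ⟨fun l => ?_, fun l => ?_⟩
  · simp only [Matrix.mul_apply (M := Pmat F n * a)]
    rw [Finset.sum_comm]
    refine Finset.sum_eq_zero fun i _ => ?_
    rw [← Finset.mul_sum]
    by_cases hi : i = Fin.last n
    · simp [hi, Matrix.mul_apply, hcol]
    · rw [sum_Qmat_row_eq_zero F n i hi, mul_zero]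
  · rw [Matrix.mul_assoc]
    simp only [Matrix.mul_apply (M := Pmat F n)]
    rw [Finset.sum_comm]
    refine Finset.sum_eq_zero fun j _ => ?_
    rw [← Finset.sum_mul]
    by_cases hj : j = Fin.last n
    · simp [hj, Matrix.mul_apply, hrow]
    · rw [sum_Pmat_col_eq_zero F n j hj, zero_mul]
end

section
/- Let F be a field and n a positive integer with (n+1 : F) ≠ 0. With P the (n+1)×(n+1) matrix having first row all 1's and, for 2 ≤ k ≤ n+1, row k with P_{k,n+1} = 1, P_{k,n+2−k} = −1 and zeros elsewhere (P is invertible since (n+1 : F) ≠ 0), the linear map a ↦ P*a*P⁻¹ is a bijection from the subspace of (n+1)×(n+1) matrices whose last row and last column are zero onto the subspace of (n+1)×(n+1) matrices all of whose row sums and column sums equal 0. -/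
open Matrix BigOperators

theorem Pmat_apply_last (F : Type*) [Field F] (n : ℕ) (i : Fin (n + 1)) :
    Pmat F n i (Fin.last n) = 1 := by
  simp [Pmat]

theorem Pmat_apply_of_ne_zero (F : Type*) [Field F] (n : ℕ) {i : Fin (n + 1)} (hi : i ≠ 0)
    (j : Fin (n + 1)) :
    Pmat F n i j = (if j = Fin.last n then 1 else 0) - (if j = Fin.rev i then 1 else 0) := by
  have hi' : (i : ℕ) ≠ 0 := fun h => hi (Fin.ext h)
  simp only [Pmat, Matrix.of_apply, Fin.ext_iff, Fin.val_rev, Fin.val_last]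
  split_ifs <;> first | omega | simp

theorem Pmat_apply_of_ne_last (F : Type*) [Field F] (n : ℕ) (i : Fin (n + 1))
    {j : Fin (n + 1)} (hj : j ≠ Fin.last n) :
    Pmat F n i j = (if i = 0 then 1 else 0) - (if i = Fin.rev j then 1 else 0) := by
  have hj' : (j : ℕ) ≠ n := fun h => hj (Fin.ext h)
  simp only [Pmat, Matrix.of_apply, Fin.ext_iff, Fin.val_rev, Fin.val_zero]
  split_ifs <;> first | omega | simp

theorem Pmat_mulVec_single_last (F : Type*) [Field F] (n : ℕ) :
    Pmat F n *ᵥ Pi.single (Fin.last n) 1 = 1 := by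
  ext i
  simp [Pmat_apply_last]

theorem one_vecMul_Pmat (F : Type*) [Field F] (n : ℕ) :
    (1 : Fin (n + 1) → F) ᵥ* Pmat F n = ((n : F) + 1) • Pi.single (Fin.last n) 1 := by
  ext j
  by_cases hj : j = Fin.last n
  · subst hj
    simp [Matrix.vecMul, dotProduct, Pmat_apply_last]
  · simp [Matrix.vecMul, dotProduct, Pmat_apply_of_ne_last F n _ hj, hj]

theorem isUnit_det_Pmat (F : Type*) [Field F] (n : ℕ) (hchar : ((n : F) + 1) ≠ 0) :
    IsUnit (Pmat F n).det := by
  rw [isUnit_iff_ne_zero]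
  intro hdet
  obtain ⟨v, hv, hPv⟩ := Matrix.exists_mulVec_eq_zero_iff.mpr hdet
  have hlast : v (Fin.last n) = 0 := by
    have h : (1 : Fin (n + 1) → F) ⬝ᵥ (Pmat F n *ᵥ v) = 0 := by simp [hPv]
    rw [Matrix.dotProduct_mulVec, one_vecMul_Pmat] at h
    simpa [hchar] using h
  apply hv
  ext j
  by_cases hj : j = Fin.last n
  · simp [hj, hlast]
  · have hj' : Fin.rev j ≠ 0 := by
      rwa [Ne, Fin.rev_eq_iff, Fin.rev_zero]
    have h := congrFun hPv (Fin.rev j)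
    simpa [Matrix.mulVec, dotProduct, Pmat_apply_of_ne_zero F n hj', sub_mul,
      Finset.sum_sub_distrib, hlast] using h

/-- Conjugation by `P` turns the vanishing of the last row and column into the vanishing of all
row and column sums. -/
theorem Pmat_mul_eq_mul_Pmat_zero_sums_iff (F : Type*) [Field F] (n : ℕ)
    (hchar : ((n : F) + 1) ≠ 0) {a b : Matrix (Fin (n + 1)) (Fin (n + 1)) F}
    (hab : Pmat F n * a = b * Pmat F n) :
    ((∀ l, ∑ k, b l k = 0) ∧ (∀ l, ∑ k, b k l = 0)) ↔
      ((∀ j, a (Fin.last n) j = 0) ∧ (∀ i, a i (Fin.last n) = 0)) := by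
  have hP := isUnit_det_Pmat F n hchar
  have hrow : b *ᵥ 1 = Pmat F n *ᵥ a.col (Fin.last n) := by
    rw [← Pmat_mulVec_single_last, Matrix.mulVec_mulVec, ← hab, ← Matrix.mulVec_mulVec,
      Matrix.mulVec_single_one]
  have hcol : (1 ᵥ* b) ᵥ* Pmat F n = ((n : F) + 1) • a.row (Fin.last n) := by
    rw [Matrix.vecMul_vecMul, ← hab, ← Matrix.vecMul_vecMul, one_vecMul_Pmat,
      Matrix.smul_vecMul, Matrix.single_one_vecMul]
  have hrow' : (∀ l, ∑ k, b l k = 0) ↔ b *ᵥ 1 = 0 := by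
    simp [funext_iff, Matrix.mulVec, dotProduct]
  have hcol' : (∀ l, ∑ k, b k l = 0) ↔ 1 ᵥ* b = 0 := by
    simp [funext_iff, Matrix.vecMul, dotProduct]
  have hinj := Matrix.mulVec_injective_iff_isUnit.mpr ((Matrix.isUnit_iff_isUnit_det _).mpr hP)
  have hinj' := Matrix.vecMul_injective_iff_isUnit.mpr ((Matrix.isUnit_iff_isUnit_det _).mpr hP)
  have h1 : b *ᵥ 1 = 0 ↔ a.col (Fin.last n) = 0 := by
    rw [hrow, hinj.eq_iff' (Matrix.mulVec_zero _)]
  have h2 : 1 ᵥ* b = 0 ↔ a.row (Fin.last n) = 0 := by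
    rw [← hinj'.eq_iff, hcol, Matrix.zero_vecMul, smul_eq_zero_iff_right hchar]
  rw [hrow', hcol', h1, h2, and_comm]
  simp [funext_iff]

/-- If `n + 1 ≠ 0` in `F`, the map `a ↦ P * a * P⁻¹` is a bijection from the subspace
of matrices whose last row and last column vanish onto the subspace of matrices all of
whose row sums and column sums equal `0`. -/
theorem Pmat_conj_bijOn_zero_sums (F : Type*) [Field F] (n : ℕ) (hn : 0 < n)
    (hchar : ((n : F) + 1) ≠ 0) :
    Set.BijOn (fun a : Matrix (Fin (n + 1)) (Fin (n + 1)) F => Pmat F n * a * (Pmat F n)⁻¹)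
      {a | (∀ j, a (Fin.last n) j = 0) ∧ (∀ i, a i (Fin.last n) = 0)}
      {a | (∀ l, ∑ k, a l k = 0) ∧ (∀ l, ∑ k, a k l = 0)} := by
  have hP := isUnit_det_Pmat F n hchar
  have hl := Matrix.nonsing_inv_mul _ hP
  have hr := Matrix.mul_nonsing_inv _ hP
  refine Set.InvOn.bijOn (f' := fun b => (Pmat F n)⁻¹ * b * Pmat F n) ⟨?_, ?_⟩ ?_ ?_
  · intro a _
    simp [Matrix.mul_assoc, hl, Matrix.nonsing_inv_mul_cancel_left _ _ hP]
  · intro b _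
    simp [Matrix.mul_assoc, hr, Matrix.mul_nonsing_inv_cancel_left _ _ hP]
  · intro a ha
    refine (Pmat_mul_eq_mul_Pmat_zero_sums_iff F n hchar ?_).mpr ha
    simp [Matrix.mul_assoc, hl]
  · intro b hb
    refine (Pmat_mul_eq_mul_Pmat_zero_sums_iff F n hchar ?_).mp hb
    simp [Matrix.mul_assoc, Matrix.mul_nonsing_inv_cancel_left _ _ hP]
end

section
/- Let F be a field and n a positive integer. With P and Q the (n+1)×(n+1) matrices defined by: P has first row all 1's and for 2 ≤ k ≤ n+1 its row k has P_{k,n+1} = 1, P_{k,n+2−k} = −1 and zeros elsewhere; Q has last row all 1's and for 1 ≤ k ≤ n its row k has Q_{k,n+2−k} = −n and all other entries 1. Then P * diag(−1,…,−1,n) * Q = (n+1)·(J_{n+1} − I_{n+1}), where diag(−1,…,−1,n) is the diagonal matrix with first n diagonal entries −1 and last diagonal entry n. In particular, if (n : F) ≠ 0 and (n+1 : F) ≠ 0, then P * diag(−1/n,…,−1/n,1) * P⁻¹ = (1/n)·(J_{n+1} − I_{n+1}). -/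
open Matrix BigOperators

private lemma castSucc_add_succ_eq_iff {n : ℕ} (k i : Fin n) :
    (k : ℕ) + ((i : ℕ) + 1) = n ↔ k = i.rev := by
  rw [Fin.ext_iff, Fin.val_rev]
  omega

/-- The product `P * diag(b,…,b,a) * Q` equals `(a - b)·J + (n+1)b·I`. -/
theorem Pmat_mul_diagonal_mul_Qmat (F : Type*) [Field F] (n : ℕ) (a b : F) :
    Pmat F n * Matrix.diagonal (fun k : Fin (n + 1) => if k = Fin.last n then a else b)
        * Qmat F n
      = (a - b) • Matrix.of (fun _ _ : Fin (n + 1) => (1 : F))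
        + (((n : F) + 1) * b) • (1 : Matrix (Fin (n + 1)) (Fin (n + 1)) F) := by
  ext i j
  have hP0 (k : Fin n) : Pmat F n 0 k.castSucc = 1 := by simp [Pmat]
  have hPs (i k : Fin n) : Pmat F n i.succ k.castSucc = if k = i.rev then -1 else 0 := by
    simp [Pmat, k.isLt.ne, ← castSucc_add_succ_eq_iff k i, add_comm (k : ℕ)]
  have hPl (i : Fin (n + 1)) : Pmat F n i (Fin.last n) = 1 := by simp [Pmat]
  have hQ0 (k : Fin n) : Qmat F n k.castSucc 0 = 1 := by simp [Qmat, k.isLt.ne]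
  have hQs (k j : Fin n) :
      Qmat F n k.castSucc j.succ = 1 - if k = j.rev then (n : F) + 1 else 0 := by
    simp only [Qmat, Matrix.of_apply, Fin.val_castSucc, k.isLt.ne, if_false, Fin.val_succ,
      castSucc_add_succ_eq_iff]
    split_ifs <;> ring
  have hQl (j : Fin (n + 1)) : Qmat F n (Fin.last n) j = 1 := by simp [Qmat]
  rw [Matrix.mul_apply, Fin.sum_univ_castSucc]
  simp only [Matrix.mul_diagonal, Fin.castSucc_ne_last, if_false, if_true, hPl, hQl]
  cases i using Fin.cases with
  | zero =>
    cases j using Fin.cases with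
    | zero =>
      simp [hP0, hQ0]
      ring
    | succ j =>
      simp [hP0, hQs, mul_sub, (Fin.succ_ne_zero j).symm]
      ring
  | succ i =>
    cases j using Fin.cases with
    | zero =>
      simp [hPs, hQ0]
      ring
    | succ j =>
      simp [hPs, hQs, Matrix.one_apply]
      split_ifs <;> ring

theorem Pmat_mul_Qmat (F : Type*) [Field F] (n : ℕ) :
    Pmat F n * Qmat F n = ((n : F) + 1) • (1 : Matrix (Fin (n + 1)) (Fin (n + 1)) F) := by
  simpa using Pmat_mul_diagonal_mul_Qmat F n 1 1

/-- `P * diag(-1,…,-1,n) * Q = (n+1)·(J - I)` where `J` is the all-ones matrix;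
in particular, if `n ≠ 0` and `n + 1 ≠ 0` in `F`, then
`P * diag(-1/n,…,-1/n,1) * P⁻¹ = (1/n)·(J - I)`. -/
theorem Pmat_traceless_base_conj (F : Type*) [Field F] (n : ℕ) (hn : 0 < n) :
    Pmat F n * Matrix.diagonal (fun k : Fin (n + 1) => if k = Fin.last n then (n : F) else -1)
        * Qmat F n
      = ((n : F) + 1) • (Matrix.of (fun _ _ : Fin (n + 1) => (1 : F))
          - (1 : Matrix (Fin (n + 1)) (Fin (n + 1)) F)) ∧
    ((n : F) ≠ 0 → ((n : F) + 1) ≠ 0 →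
      Pmat F n * Matrix.diagonal
            (fun k : Fin (n + 1) => if k = Fin.last n then (1 : F) else -(1 / (n : F)))
          * (Pmat F n)⁻¹
        = (1 / (n : F)) • (Matrix.of (fun _ _ : Fin (n + 1) => (1 : F))
            - (1 : Matrix (Fin (n + 1)) (Fin (n + 1)) F))) := by
  refine ⟨?_, fun h0 h1 => ?_⟩
  · rw [Pmat_mul_diagonal_mul_Qmat]
    match_scalars <;> ring
  · have hinv : (Pmat F n)⁻¹ = ((n : F) + 1)⁻¹ • Qmat F n := by
      apply Matrix.inv_eq_right_inv
      rw [Matrix.mul_smul, Pmat_mul_Qmat, smul_smul, inv_mul_cancel₀ h1, one_smul]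
    rw [hinv, Matrix.mul_smul, Pmat_mul_diagonal_mul_Qmat]
    match_scalars <;> field_simp <;> ring
end

section
/- Let n be a positive integer and let U be a real orthogonal (n+1)×(n+1) matrix (Uᵀ*U = I_{n+1}) whose last column has all entries equal to 1/√(n+1). Then the map f(a) := U*a*Uᵀ is a bijection from the set of (n+1)×(n+1) real matrices of block form with upper-left n×n block B satisfying B + Bᵀ = 2·I_n, zero last row and last column except the (n+1,n+1) entry equal to 1, onto the set ona(n) of (n+1)×(n+1) real matrices a such that every row sum and every column sum of a equals 1 and a + aᵀ = 2·I_{n+1}; moreover f preserves the affine commutator bracket: f(a*b − b*a + b) = f(a)*f(b) − f(b)*f(a) + f(b). -/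
open Matrix BigOperators

/-- Matrices with unit diagonal and anti-symmetric off-diagonal part that fix the vector `v`
from both sides. -/
def unitDiagonalFixing {m : Type*} [Fintype m] [DecidableEq m] (v : m → ℝ) :
    Set (Matrix m m ℝ) :=
  {a | a *ᵥ v = v ∧ v ᵥ* a = v ∧ a + aᵀ = (2 : ℝ) • (1 : Matrix m m ℝ)}

theorem conj_mem_unitDiagonalFixing {m : Type*} [Fintype m] [DecidableEq m]
    {V a : Matrix m m ℝ} {v : m → ℝ} (hV : Vᵀ * V = 1) (ha : a ∈ unitDiagonalFixing v) :
    V * a * Vᵀ ∈ unitDiagonalFixing (V *ᵥ v) := by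
  obtain ⟨h₁, h₂, h₃⟩ := ha
  refine ⟨?_, ?_, ?_⟩
  · rw [mulVec_mulVec, Matrix.mul_assoc, hV, Matrix.mul_one, ← mulVec_mulVec, h₁]
  · rw [← vecMul_transpose, vecMul_vecMul, ← Matrix.mul_assoc, ← Matrix.mul_assoc, hV,
      Matrix.one_mul, ← vecMul_vecMul, h₂]
  · calc V * a * Vᵀ + (V * a * Vᵀ)ᵀ = V * (a + aᵀ) * Vᵀ := by
          simp only [transpose_mul, transpose_transpose, Matrix.mul_add, Matrix.add_mul,
            Matrix.mul_assoc]
      _ = (2 : ℝ) • 1 := by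
          rw [h₃, Matrix.mul_smul, Matrix.smul_mul, Matrix.mul_one, mul_eq_one_comm.mp hV]

theorem unitDiagonalFixing_smul {m : Type*} [Fintype m] [DecidableEq m] {c : ℝ} (hc : c ≠ 0)
    (v : m → ℝ) : unitDiagonalFixing (c • v) = unitDiagonalFixing v := by
  ext a
  simp only [unitDiagonalFixing, Set.mem_ofPred_eq, mulVec_smul, smul_vecMul,
    (smul_right_injective (m → ℝ) hc).eq_iff]

theorem bijOn_conj_unitDiagonalFixing {m : Type*} [Fintype m] [DecidableEq m]
    {V : Matrix m m ℝ} (hV : Vᵀ * V = 1) (v : m → ℝ) :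
    Set.BijOn (fun a => V * a * Vᵀ) (unitDiagonalFixing v) (unitDiagonalFixing (V *ᵥ v)) := by
  have hV' : V * Vᵀ = 1 := mul_eq_one_comm.mp hV
  refine Set.InvOn.bijOn (f' := fun b => Vᵀ * b * V) ⟨fun a _ => ?_, fun b _ => ?_⟩
    (fun a ha => conj_mem_unitDiagonalFixing hV ha) fun b hb => ?_
  · calc Vᵀ * (V * a * Vᵀ) * V = (Vᵀ * V) * a * (Vᵀ * V) := by
          simp only [Matrix.mul_assoc]
      _ = a := by rw [hV, Matrix.one_mul, Matrix.mul_one]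
  · calc V * (Vᵀ * b * V) * Vᵀ = (V * Vᵀ) * b * (V * Vᵀ) := by
          simp only [Matrix.mul_assoc]
      _ = b := by rw [hV', Matrix.one_mul, Matrix.mul_one]
  · have h := conj_mem_unitDiagonalFixing (V := Vᵀ) (by rwa [transpose_transpose]) hb
    rwa [mulVec_mulVec, hV, one_mulVec, transpose_transpose] at h

theorem unitDiagonalFixing_one {m : Type*} [Fintype m] [DecidableEq m] :
    unitDiagonalFixing (1 : m → ℝ) =
      {a | (∀ l, ∑ k, a l k = 1) ∧ (∀ l, ∑ k, a k l = 1) ∧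
        a + aᵀ = (2 : ℝ) • (1 : Matrix m m ℝ)} := by
  ext a
  simp [unitDiagonalFixing, funext_iff, mulVec, vecMul, dotProduct]

theorem unitDiagonalFixing_single_last (n : ℕ) :
    unitDiagonalFixing (Pi.single (Fin.last n) 1) =
      {a | a (Fin.last n) (Fin.last n) = 1 ∧
        (∀ j, j ≠ Fin.last n → a (Fin.last n) j = 0 ∧ a j (Fin.last n) = 0) ∧
        a.submatrix Fin.castSucc Fin.castSucc
          + (a.submatrix Fin.castSucc Fin.castSucc)ᵀ
          = (2 : ℝ) • (1 : Matrix (Fin n) (Fin n) ℝ)} := by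
  ext a
  simp only [unitDiagonalFixing, Set.mem_ofPred_eq, mulVec_single_one, single_one_vecMul]
  constructor
  · rintro ⟨h₁, h₂, h₃⟩
    refine ⟨by simpa using congrFun h₁ (Fin.last n), fun j hj => ⟨?_, ?_⟩, ?_⟩
    · simpa [hj] using congrFun h₂ j
    · simpa [hj] using congrFun h₁ j
    · ext i j
      simpa [one_apply] using congrFun₂ h₃ i.castSucc j.castSucc
  · rintro ⟨h₁, h₂, h₃⟩
    refine ⟨?_, ?_, ?_⟩
    · ext j
      by_cases hj : j = Fin.last n
      · simp [hj, h₁]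
      · simp [hj, h₂ j hj]
    · ext j
      by_cases hj : j = Fin.last n
      · simp [hj, h₁]
      · simp [hj, h₂ j hj]
    · ext i j
      induction i using Fin.lastCases with
      | last =>
        by_cases hj : j = Fin.last n
        · subst hj
          norm_num [h₁]
        · simp [h₂ j hj, one_apply_ne' hj]
      | cast i =>
        induction j using Fin.lastCases with
        | last => simp [h₂ i.castSucc (Fin.castSucc_ne_last i)]
        | cast j => simpa [one_apply] using congrFun₂ h₃ i j

/-- If `U` is a real orthogonal `(n+1)×(n+1)` matrix whose last column has all entries
`1/√(n+1)`, then `a ↦ U * a * Uᵀ` is a bijection from the set of block matrices with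
upper-left `n×n` block `B` satisfying `B + Bᵀ = 2·I`, zero last row and column except
the `(n+1,n+1)` entry equal to `1`, onto `ona(n)` (all row and column sums equal `1`
and `a + aᵀ = 2·I`), and it preserves the affine commutator bracket. -/
theorem unitary_conj_ona (n : ℕ) (hn : 0 < n)
    (U : Matrix (Fin (n + 1)) (Fin (n + 1)) ℝ)
    (hU : Uᵀ * U = 1) (hcol : ∀ k, U k (Fin.last n) = (Real.sqrt (n + 1))⁻¹) :
    Set.BijOn (fun a : Matrix (Fin (n + 1)) (Fin (n + 1)) ℝ => U * a * Uᵀ)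
      {a | a (Fin.last n) (Fin.last n) = 1 ∧
           (∀ j, j ≠ Fin.last n → a (Fin.last n) j = 0 ∧ a j (Fin.last n) = 0) ∧
           a.submatrix Fin.castSucc Fin.castSucc
             + (a.submatrix Fin.castSucc Fin.castSucc)ᵀ
             = (2 : ℝ) • (1 : Matrix (Fin n) (Fin n) ℝ)}
      {a | (∀ l, ∑ k, a l k = 1) ∧ (∀ l, ∑ k, a k l = 1) ∧
           a + aᵀ = (2 : ℝ) • (1 : Matrix (Fin (n + 1)) (Fin (n + 1)) ℝ)} ∧
    ∀ a b : Matrix (Fin (n + 1)) (Fin (n + 1)) ℝ,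
      U * (a * b - b * a + b) * Uᵀ =
        (U * a * Uᵀ) * (U * b * Uᵀ) - (U * b * Uᵀ) * (U * a * Uᵀ) + U * b * Uᵀ := by
  have hc : (Real.sqrt (n + 1))⁻¹ ≠ 0 := by positivity
  have hUe : U *ᵥ Pi.single (Fin.last n) 1 = (Real.sqrt (n + 1))⁻¹ • (1 : Fin (n + 1) → ℝ) := by
    ext k
    simp [hcol]
  refine ⟨?_, fun a b => ?_⟩
  · have h := bijOn_conj_unitDiagonalFixing hU (Pi.single (Fin.last n) 1)
    rwa [hUe, unitDiagonalFixing_smul hc, unitDiagonalFixing_one,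
      unitDiagonalFixing_single_last] at h
  · have hmul (x y : Matrix (Fin (n + 1)) (Fin (n + 1)) ℝ) :
        (U * x * Uᵀ) * (U * y * Uᵀ) = U * (x * y) * Uᵀ := by
      calc (U * x * Uᵀ) * (U * y * Uᵀ) = U * x * (Uᵀ * U) * y * Uᵀ := by
            simp only [Matrix.mul_assoc]
        _ = U * (x * y) * Uᵀ := by
            rw [hU, Matrix.mul_one, Matrix.mul_assoc U x y]
    rw [hmul, hmul, Matrix.mul_add, Matrix.mul_sub, Matrix.add_mul, Matrix.sub_mul]
end

section
/- Let n be a positive integer and let U be a complex unitary (n+1)×(n+1) matrix with real entries (equivalently, real orthogonal, Uᴴ*U = I_{n+1}) whose last column has all entries equal to 1/√(n+1). Then the map f(a) := U*a*Uᴴ is a bijection from the set of (n+1)×(n+1) complex matrices of block form with upper-left n×n block A satisfying Aᴴ = −A, zero last row and last column except the (n+1,n+1) entry equal to i, onto the set una(n) of (n+1)×(n+1) complex matrices a such that every row sum and every column sum of a equals i and aᴴ = −a; moreover f preserves the affine commutator bracket: f(a*b − b*a + b) = f(a)*f(b) − f(b)*f(a) + f(b). -/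
open Matrix BigOperators

theorem antihermitian_apply {m : Type*} {a : Matrix m m ℂ} (ha : aᴴ = -a) (i j : m) :
    a i j = -star (a j i) := by
  simpa [eq_neg_iff_add_eq_zero, add_comm] using congr_fun₂ ha i j

section

variable {m : Type*} [Fintype m]

theorem bijOn_unitary_conj_antihermitian_eigenvector [DecidableEq m] {U : Matrix m m ℂ}
    (hU : Uᴴ * U = 1) (v : m → ℂ) (μ : ℂ) :
    Set.BijOn (fun a => U * a * Uᴴ)
      {a | a *ᵥ v = μ • v ∧ aᴴ = -a}
      {a | a *ᵥ (U *ᵥ v) = μ • (U *ᵥ v) ∧ aᴴ = -a} := by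
  have hU' : U * Uᴴ = 1 := mul_eq_one_comm.mp hU
  refine Set.InvOn.bijOn (f' := fun b => Uᴴ * b * U) ⟨fun a _ => ?_, fun b _ => ?_⟩ ?_ ?_
  · calc Uᴴ * (U * a * Uᴴ) * U = (Uᴴ * U) * a * (Uᴴ * U) := by simp only [Matrix.mul_assoc]
      _ = a := by simp [hU]
  · calc U * (Uᴴ * b * U) * Uᴴ = (U * Uᴴ) * b * (U * Uᴴ) := by simp only [Matrix.mul_assoc]
      _ = b := by simp [hU']
  · rintro a ⟨hv, ha⟩
    refine ⟨?_, by simp [ha, Matrix.mul_assoc]⟩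
    simp only [mulVec_mulVec, Matrix.mul_assoc, hU, Matrix.mul_one]
    rw [← mulVec_mulVec, hv, mulVec_smul]
  · rintro b ⟨hv, hb⟩
    refine ⟨?_, by simp [hb, Matrix.mul_assoc]⟩
    simp only [← mulVec_mulVec, hv, mulVec_smul]
    rw [mulVec_mulVec, hU, one_mulVec]

theorem sum_eq_I_antihermitian_iff (a : Matrix m m ℂ) :
    ((∀ l, ∑ k, a l k = Complex.I) ∧ (∀ l, ∑ k, a k l = Complex.I) ∧ aᴴ = -a) ↔
      a *ᵥ 1 = Complex.I • 1 ∧ aᴴ = -a := by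
  have hrow : a *ᵥ 1 = Complex.I • 1 ↔ ∀ l, ∑ k, a l k = Complex.I := by
    simp [funext_iff, mulVec, dotProduct]
  rw [hrow]
  refine ⟨fun h => ⟨h.1, h.2.2⟩, fun h => ⟨h.1, fun l => ?_, h.2⟩⟩
  rw [Finset.sum_congr rfl fun k _ => antihermitian_apply h.2 k l, Finset.sum_neg_distrib,
    ← star_sum, h.1]
  simp

end

theorem corner_I_antihermitian_iff {n : ℕ} (a : Matrix (Fin (n + 1)) (Fin (n + 1)) ℂ) :
    (a (Fin.last n) (Fin.last n) = Complex.I ∧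
      (∀ j, j ≠ Fin.last n → a (Fin.last n) j = 0 ∧ a j (Fin.last n) = 0) ∧
      (a.submatrix Fin.castSucc Fin.castSucc)ᴴ = -(a.submatrix Fin.castSucc Fin.castSucc)) ↔
      a *ᵥ Pi.single (Fin.last n) 1 = Complex.I • Pi.single (Fin.last n) 1 ∧ aᴴ = -a := by
  have hcol : a *ᵥ Pi.single (Fin.last n) 1 = Complex.I • Pi.single (Fin.last n) 1 ↔
      a (Fin.last n) (Fin.last n) = Complex.I ∧ ∀ j, j ≠ Fin.last n → a j (Fin.last n) = 0 := by
    rw [mulVec_single_one]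
    constructor
    · intro h
      refine ⟨by simpa using congr_fun h (Fin.last n), fun j hj => ?_⟩
      simpa [hj] using congr_fun h j
    · rintro ⟨h, h0⟩
      ext j
      by_cases hj : j = Fin.last n
      · simp [hj, h]
      · simp [hj, h0]
  rw [hcol]
  constructor
  · rintro ⟨h, h0, hA⟩
    refine ⟨⟨h, fun j hj => (h0 j hj).2⟩, ?_⟩
    ext i j
    induction i using Fin.lastCases with
    | last =>
      induction j using Fin.lastCases with
      | last => simp [h]
      | cast j => simp [h0 _ (Fin.castSucc_ne_last j)]
    | cast i =>
      induction j using Fin.lastCases with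
      | last => simp [h0 _ (Fin.castSucc_ne_last i)]
      | cast j => simpa using congr_fun₂ hA i j
  · rintro ⟨⟨h, h0⟩, ha⟩
    refine ⟨h, fun j hj => ⟨?_, h0 j hj⟩, ?_⟩
    · rw [antihermitian_apply ha, h0 j hj]
      simp
    · rw [conjTranspose_submatrix, ha]
      rfl

open Matrix BigOperators

/-- If `U` is a complex unitary `(n+1)×(n+1)` matrix with real entries whose last
column has all entries `1/√(n+1)`, then `a ↦ U * a * Uᴴ` is a bijection from the set
of block matrices with anti-hermitian upper-left `n×n` block, zero last row and column
except the `(n+1,n+1)` entry equal to `i`, onto `una(n)` (all row and column sums equal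
`i` and `aᴴ = -a`), and it preserves the affine commutator bracket. -/
theorem unitary_conj_una (n : ℕ) (hn : 0 < n)
    (U : Matrix (Fin (n + 1)) (Fin (n + 1)) ℂ)
    (hreal : ∀ i j, (U i j).im = 0)
    (hU : Uᴴ * U = 1)
    (hcol : ∀ k, U k (Fin.last n) = ((Real.sqrt (n + 1) : ℝ) : ℂ)⁻¹) :
    Set.BijOn (fun a : Matrix (Fin (n + 1)) (Fin (n + 1)) ℂ => U * a * Uᴴ)
      {a | a (Fin.last n) (Fin.last n) = Complex.I ∧
           (∀ j, j ≠ Fin.last n → a (Fin.last n) j = 0 ∧ a j (Fin.last n) = 0) ∧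
           (a.submatrix Fin.castSucc Fin.castSucc)ᴴ = -(a.submatrix Fin.castSucc Fin.castSucc)}
      {a | (∀ l, ∑ k, a l k = Complex.I) ∧ (∀ l, ∑ k, a k l = Complex.I) ∧ aᴴ = -a} ∧
    ∀ a b : Matrix (Fin (n + 1)) (Fin (n + 1)) ℂ,
      U * (a * b - b * a + b) * Uᴴ =
        (U * a * Uᴴ) * (U * b * Uᴴ) - (U * b * Uᴴ) * (U * a * Uᴴ) + U * b * Uᴴ := by
  set c : ℂ := ((Real.sqrt (n + 1) : ℝ) : ℂ)⁻¹ with hc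
  have hc0 : c ≠ 0 := by
    rw [hc]
    exact inv_ne_zero (Complex.ofReal_ne_zero.mpr (Real.sqrt_ne_zero'.mpr (by positivity)))
  have hlast : U *ᵥ Pi.single (Fin.last n) 1 = c • 1 := by
    rw [mulVec_single_one]
    ext k
    simp [hcol]
  constructor
  · have h := bijOn_unitary_conj_antihermitian_eigenvector hU (Pi.single (Fin.last n) 1) Complex.I
    simp only [hlast, mulVec_smul, smul_comm Complex.I c, (smul_right_injective _ hc0).eq_iff] at h
    simpa only [corner_I_antihermitian_iff, sum_eq_I_antihermitian_iff] using h
  · intro a b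
    have h (x y : Matrix (Fin (n + 1)) (Fin (n + 1)) ℂ) :
        (U * x * Uᴴ) * (U * y * Uᴴ) = U * (x * y) * Uᴴ := by
      calc (U * x * Uᴴ) * (U * y * Uᴴ) = U * x * (Uᴴ * U) * y * Uᴴ := by
            simp only [Matrix.mul_assoc]
        _ = U * (x * y) * Uᴴ := by simp only [hU, Matrix.mul_one, Matrix.mul_assoc]
    simp only [h, Matrix.mul_add, Matrix.mul_sub, Matrix.add_mul, Matrix.sub_mul]
end
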